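/- Let v, w₁, w₂ ∈ ℝ, r ∈ ℝ, λ₁, λ₂ > 0, and let x₁, x₂, θ, o₁, o₂ : ℝ → ℝ be differentiable with ẋ₁(t) = v·cos θ(t), ẋ₂(t) = v·sin θ(t), θ̇(t) = ω(t), ȯ₁(t) = w₁, ȯ₂(t) = w₂ for a continuous ω : ℝ → ℝ. Define h(t) = (x₁(t) − o₁(t))² + (x₂(t) − o₂(t))² − r². Suppose that for all t ≥ 0: 2·(v·cos θ(t) − w₁)² + 2·(v·sin θ(t) − w₂)² + 2v·ω(t)·((x₂(t) − o₂(t))·cos θ(t) − (x₁(t) − o₁(t))·sin θ(t)) + (λ₁ + λ₂)·h'(t) + λ₁·λ₂·h(t) ≥ 0, and suppose h(0) ≥ 0 and h'(0) + λ₁·h(0) ≥ 0. Then for all t ≥ 0, (x₁(t) − o₁(t))² + (x₂(t) − o₂(t))² ≥ r², i.e., the robot never collides with the moving obstacle. -/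

import Mathlib

/-- If `f' + c f ≥ 0` on `[0, ∞)` and `f 0 ≥ 0`, then `f ≥ 0` on `[0, ∞)`. -/
theorem nonneg_of_hasDerivAt_add_mul_nonneg {f f' : ℝ → ℝ} {c : ℝ}
    (hf : ∀ t, HasDerivAt f (f' t) t) (hc : ∀ t, 0 ≤ t → 0 ≤ f' t + c * f t)
    (h0 : 0 ≤ f 0) {t : ℝ} (ht : 0 ≤ t) : 0 ≤ f t := by
  have hF : ∀ s, HasDerivAt (fun s => Real.exp (c * s) * f s)
      (Real.exp (c * s) * (f' s + c * f s)) s := fun s => by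
    refine ((((hasDerivAt_id' s).const_mul c).exp).mul (hf s)).congr_deriv ?_
    ring
  have hmono : MonotoneOn (fun s => Real.exp (c * s) * f s) (Set.Ici 0) := by
    refine monotoneOn_of_hasDerivWithinAt_nonneg (convex_Ici 0)
      (fun s _ => (hF s).continuousAt.continuousWithinAt)
      (fun s _ => (hF s).hasDerivWithinAt) fun s hs => ?_
    exact mul_nonneg (Real.exp_pos _).le (hc s (interior_subset hs))
  have hle := hmono Set.self_mem_Ici ht ht
  simp only [mul_zero, Real.exp_zero, one_mul] at hle
  exact nonneg_of_mul_nonneg_right (h0.trans hle) (Real.exp_pos _)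

/-- Safety of the unicycle with a moving circular obstacle under the ECBF-QP
constraint `ḧ + (λ₁+λ₂) ḣ + λ₁λ₂ h ≥ 0` with suitable initial conditions:
the robot never collides with the moving obstacle. -/
theorem unicycle_moving_obstacle_safety
    (v w1 w2 r lam1 lam2 : ℝ) (hlam1 : 0 < lam1) (hlam2 : 0 < lam2)
    (x1 x2 θ o1 o2 ω : ℝ → ℝ) (hω : Continuous ω)
    (hx1 : ∀ t, HasDerivAt x1 (v * Real.cos (θ t)) t)
    (hx2 : ∀ t, HasDerivAt x2 (v * Real.sin (θ t)) t)
    (hθ : ∀ t, HasDerivAt θ (ω t) t)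
    (ho1 : ∀ t, HasDerivAt o1 w1 t)
    (ho2 : ∀ t, HasDerivAt o2 w2 t)
    (h : ℝ → ℝ)
    (hh : h = fun t => (x1 t - o1 t) ^ 2 + (x2 t - o2 t) ^ 2 - r ^ 2)
    (hecbf : ∀ t : ℝ, 0 ≤ t →
      2 * (v * Real.cos (θ t) - w1) ^ 2 + 2 * (v * Real.sin (θ t) - w2) ^ 2
        + 2 * v * ω t *
            ((x2 t - o2 t) * Real.cos (θ t) - (x1 t - o1 t) * Real.sin (θ t))
        + (lam1 + lam2) * deriv h t + lam1 * lam2 * h t ≥ 0)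
    (h0 : h 0 ≥ 0) (h0' : deriv h 0 + lam1 * h 0 ≥ 0) :
    ∀ t : ℝ, 0 ≤ t → (x1 t - o1 t) ^ 2 + (x2 t - o2 t) ^ 2 ≥ r ^ 2 := by
  let g : ℝ → ℝ := fun t =>
    2 * ((x1 t - o1 t) * (v * Real.cos (θ t) - w1) + (x2 t - o2 t) * (v * Real.sin (θ t) - w2))
  have hg : ∀ t, HasDerivAt h (g t) t := fun t => by
    rw [hh]
    refine (((((hx1 t).sub (ho1 t)).pow 2).add
      (((hx2 t).sub (ho2 t)).pow 2)).sub_const (r ^ 2)).congr_deriv ?_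
    simp [g]
    ring
  have hg' : ∀ t, HasDerivAt g (2 * (v * Real.cos (θ t) - w1) ^ 2
      + 2 * (v * Real.sin (θ t) - w2) ^ 2 + 2 * v * ω t *
        ((x2 t - o2 t) * Real.cos (θ t) - (x1 t - o1 t) * Real.sin (θ t))) t := fun t => by
    refine (((((hx1 t).sub (ho1 t)).mul (((hθ t).cos.const_mul v).sub_const w1)).add
      (((hx2 t).sub (ho2 t)).mul (((hθ t).sin.const_mul v).sub_const w2))).const_mul 2).congr_deriv ?_
    simp only [Pi.sub_apply]
    ring
  rw [(hg 0).deriv] at h0'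
  have hf : ∀ t, 0 ≤ t → 0 ≤ g t + lam1 * h t := fun t ht =>
    nonneg_of_hasDerivAt_add_mul_nonneg (f := fun t => g t + lam1 * h t) (c := lam2)
      (fun s => (hg' s).add ((hg s).const_mul lam1))
      (fun s hs => by
        have := hecbf s hs
        rw [(hg s).deriv] at this
        linarith) h0' ht
  intro t ht
  have key := nonneg_of_hasDerivAt_add_mul_nonneg hg hf h0 ht
  rw [hh] at key
  exact sub_nonneg.mp key
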